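/- arXiv:2604.08806 — 2 statements merged into one kernel-verified Lean document; each statement's English description precedes it below -/
import Mathlib

section
/- Let I ⊆ ℝ be an open interval, r₀ > 0, and let a : I → ℝ be differentiable with 1 − r₀·a'(t) ≠ 0 on I. Let 𝒯 : I → ℝ be differentiable with 𝒯'(t) = 1/(1 − r₀·a'(t)), let A, B : ℝ → ℝ be differentiable, and let g : I → ℝ be differentiable. Suppose for all t ∈ I: (i) A(𝒯(t))·r₀·a(t) + B(𝒯(t)) = g(t), and (ii) A(𝒯(t)) + 𝒯'(t)·(r₀·a(t)·A'(𝒯(t)) + B'(𝒯(t))) = 0. Then for all t ∈ I, A(𝒯(t)) = −g'(t)/(1 − r₀·a'(t)) and B(𝒯(t)) = g(t) + g'(t)·r₀·a(t)/(1 − r₀·a'(t)). -/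
/-- Boundary determination of `A` and `B` in the FLRW–generalized-Vaidya matching in
metric `f(R)` gravity: the Ricci-scalar continuity (i) and normal-derivative
continuity (ii) determine `A(𝒯(t))` and `B(𝒯(t))` from the interior data. -/
theorem stmt_9 (I : Set ℝ) (hIopen : IsOpen I) (hIconn : I.OrdConnected)
    (r₀ : ℝ) (hr₀ : 0 < r₀)
    (a a' : ℝ → ℝ)
    (ha : ∀ t ∈ I, HasDerivAt a (a' t) t)
    (hne : ∀ t ∈ I, 1 - r₀ * a' t ≠ 0)
    (T : ℝ → ℝ)
    (hT : ∀ t ∈ I, HasDerivAt T (1 / (1 - r₀ * a' t)) t)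
    (A B A' B' : ℝ → ℝ)
    (hA : ∀ v : ℝ, HasDerivAt A (A' v) v)
    (hB : ∀ v : ℝ, HasDerivAt B (B' v) v)
    (g g' : ℝ → ℝ)
    (hg : ∀ t ∈ I, HasDerivAt g (g' t) t)
    (h1 : ∀ t ∈ I, A (T t) * (r₀ * a t) + B (T t) = g t)
    (h2 : ∀ t ∈ I,
      A (T t) + (1 / (1 - r₀ * a' t)) * (r₀ * a t * A' (T t) + B' (T t)) = 0) :
    ∀ t ∈ I,
      A (T t) = -g' t / (1 - r₀ * a' t) ∧
      B (T t) = g t + g' t * r₀ * a t / (1 - r₀ * a' t) := by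
  intro t ht
  have hderiv : g' t = A' (T t) * (1 / (1 - r₀ * a' t)) * (r₀ * a t)
      + A (T t) * (r₀ * a' t) + B' (T t) * (1 / (1 - r₀ * a' t)) := by
    have hsum := (((hA (T t)).comp t (hT t ht)).mul ((ha t ht).const_mul r₀)).add
      ((hB (T t)).comp t (hT t ht))
    have heq : g =ᶠ[nhds t] (A ∘ T) * (fun s => r₀ * a s) + B ∘ T := by
      filter_upwards [hIopen.mem_nhds ht] with s hs
      exact (h1 s hs).symm
    exact (hg t ht).unique (hsum.congr_of_eventuallyEq heq)
  have hAg : A (T t) = -g' t / (1 - r₀ * a' t) := by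
    rw [eq_div_iff (hne t ht)]
    linear_combination h2 t ht + hderiv
  refine ⟨hAg, ?_⟩
  have hB_eq : B (T t) = g t - A (T t) * (r₀ * a t) := by
    linear_combination h1 t ht
  rw [hB_eq, hAg]
  ring
end

section
/- With the hypotheses of the previous setup, suppose in addition 𝒯 is injective on I. If (A₁, B₁) and (A₂, B₂) are two pairs of differentiable functions ℝ → ℝ each satisfying, for all t ∈ I, the equations A(𝒯(t))·r₀·a(t) + B(𝒯(t)) = g(t) and A(𝒯(t)) + 𝒯'(t)·(r₀·a(t)·A'(𝒯(t)) + B'(𝒯(t))) = 0, then A₁(v) = A₂(v) and B₁(v) = B₂(v) for every v in the range 𝒯(I). -/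
/-- If `A (T t) * (r * a t) + B (T t) = g t` near `t` and the normal-derivative condition holds
at `t`, then `g` has derivative `-(1 - r * a') * A (T t)` at `t`. -/
theorem hasDerivAt_of_matching {a T A B g : ℝ → ℝ} {r t a' T' A' B' : ℝ}
    (ha : HasDerivAt a a' t) (hT : HasDerivAt T T' t)
    (hA : HasDerivAt A A' (T t)) (hB : HasDerivAt B B' (T t))
    (hg : ∀ᶠ s in nhds t, A (T s) * (r * a s) + B (T s) = g s)
    (hn : A (T t) + T' * (r * a t * A' + B') = 0) :
    HasDerivAt g (-(1 - r * a') * A (T t)) t := by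
  have h := ((hA.comp t hT).mul (ha.const_mul r)).add (hB.comp t hT)
  refine (h.congr_deriv ?_).congr_of_eventuallyEq (hg.mono fun s hs => hs.symm)
  simp only [Function.comp_apply]
  linear_combination hn

/-- Uniqueness of `A` and `B` on the range of `𝒯`: with `𝒯` injective on `I`, any two
pairs of differentiable functions satisfying the Ricci-scalar continuity and
normal-derivative continuity conditions agree on `𝒯(I)`. -/
theorem stmt_10 (I : Set ℝ) (hIopen : IsOpen I) (hIconn : I.OrdConnected)
    (r₀ : ℝ) (hr₀ : 0 < r₀)
    (a a' : ℝ → ℝ)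
    (ha : ∀ t ∈ I, HasDerivAt a (a' t) t)
    (hne : ∀ t ∈ I, 1 - r₀ * a' t ≠ 0)
    (T : ℝ → ℝ)
    (hT : ∀ t ∈ I, HasDerivAt T (1 / (1 - r₀ * a' t)) t)
    (hinj : Set.InjOn T I)
    (g : ℝ → ℝ)
    (hg : DifferentiableOn ℝ g I)
    (A₁ B₁ A₁' B₁' A₂ B₂ A₂' B₂' : ℝ → ℝ)
    (hA₁ : ∀ v : ℝ, HasDerivAt A₁ (A₁' v) v)
    (hB₁ : ∀ v : ℝ, HasDerivAt B₁ (B₁' v) v)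
    (hA₂ : ∀ v : ℝ, HasDerivAt A₂ (A₂' v) v)
    (hB₂ : ∀ v : ℝ, HasDerivAt B₂ (B₂' v) v)
    (h1₁ : ∀ t ∈ I, A₁ (T t) * (r₀ * a t) + B₁ (T t) = g t)
    (h2₁ : ∀ t ∈ I,
      A₁ (T t) + (1 / (1 - r₀ * a' t)) * (r₀ * a t * A₁' (T t) + B₁' (T t)) = 0)
    (h1₂ : ∀ t ∈ I, A₂ (T t) * (r₀ * a t) + B₂ (T t) = g t)
    (h2₂ : ∀ t ∈ I,
      A₂ (T t) + (1 / (1 - r₀ * a' t)) * (r₀ * a t * A₂' (T t) + B₂' (T t)) = 0) :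
    ∀ v ∈ T '' I, A₁ v = A₂ v ∧ B₁ v = B₂ v := by
  rintro _ ⟨t, ht, rfl⟩
  have hI := hIopen.mem_nhds ht
  have d₁ := hasDerivAt_of_matching (ha t ht) (hT t ht) (hA₁ _) (hB₁ _)
    (Filter.eventually_of_mem hI h1₁) (h2₁ t ht)
  have d₂ := hasDerivAt_of_matching (ha t ht) (hT t ht) (hA₂ _) (hB₂ _)
    (Filter.eventually_of_mem hI h1₂) (h2₂ t ht)
  have hA : A₁ (T t) = A₂ (T t) :=
    mul_left_cancel₀ (neg_ne_zero.mpr (hne t ht)) (d₁.unique d₂)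
  refine ⟨hA, ?_⟩
  linear_combination h1₁ t ht - h1₂ t ht - r₀ * a t * hA
end
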